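/- Let p ∈ ℝ^{d_p} and q ∈ ℝ^{d_q} be probability distributions with H(p) > 0, H(q) > 0, V(p) > 0 and V(q) > 0, and let s denote a sharp distribution. Let (t_n) be a moderate sequence, and set ε_n^− = e^{−n t_n²} and ε_n^+ = 1 − e^{−n t_n²}. For ε ≥ 0 define R_n^{ent}(ε) = (1/n)·sup{ m ∈ ℕ : p^{⊗n} ⊗ s^{⊗m} ≺_ε q^{⊗m} ⊗ s^{⊗n} }, where ≺_ε is approximate majorisation with total variation error. Set ν = (V(p)/H(p)) / (V(q)/H(q)). Then, for both choices of sign, lim_{n→∞} ( R_n^{ent}(ε_n^±) − H(p)/H(q) ) / t_n = ±(√(2 V(p)) / H(q)) · |1 ± 1/√ν|. -/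

import Mathlib

open Finset Filter Real Topology

noncomputable section

/-- A probability distribution on a finite type: nonnegative entries summing to 1. -/
def IsProbDist {α : Type*} [Fintype α] (a : α → ℝ) : Prop :=
  (∀ i, 0 ≤ a i) ∧ ∑ i, a i = 1

/-- A sharp distribution: a single entry equal to 1, all others 0. -/
def IsSharp {α : Type*} [Fintype α] (a : α → ℝ) : Prop :=
  ∃ i, a i = 1 ∧ ∀ j, j ≠ i → a j = 0

/-- The uniform distribution: all entries equal to `1 / |α|`. -/
def IsUniform {α : Type*} [Fintype α] (a : α → ℝ) : Prop :=
  ∀ i, a i = 1 / (Fintype.card α : ℝ)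

/-- Tensor (Kronecker) product of two vectors. -/
def tensor {α β : Type*} (a : α → ℝ) (b : β → ℝ) : α × β → ℝ :=
  fun x => a x.1 * b x.2

/-- `n`-fold tensor power of a vector. -/
def tpow {α : Type*} (a : α → ℝ) (n : ℕ) : (Fin n → α) → ℝ :=
  fun f => ∏ j, a (f j)

/-- Shannon entropy (natural logarithm, with the convention `0 · ln 0 = 0`). -/
def shannonH {α : Type*} [Fintype α] (a : α → ℝ) : ℝ :=
  -∑ i, a i * Real.log (a i)

/-- Entropy variance `V(a) = ∑ i, a i (ln a i + H(a))²`. -/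
def entV {α : Type*} [Fintype α] (a : α → ℝ) : ℝ :=
  ∑ i, a i * (Real.log (a i) + shannonH a) ^ 2

/-- Relative entropy `D(a‖b)`. -/
def relD {α : Type*} [Fintype α] (a b : α → ℝ) : ℝ :=
  ∑ i, a i * Real.log (a i / b i)

/-- Relative entropy variance `V(a‖b)`. -/
def relV {α : Type*} [Fintype α] (a b : α → ℝ) : ℝ :=
  ∑ i, a i * (Real.log (a i / b i) - relD a b) ^ 2

/-- Total variation distance. -/
def tvd {α : Type*} [Fintype α] (a b : α → ℝ) : ℝ :=
  (1 / 2) * ∑ i, |a i - b i|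

/-- Fidelity `F(a,b) = (∑ i √(a i · b i))²`. -/
def fid {α : Type*} [Fintype α] (a b : α → ℝ) : ℝ :=
  (∑ i, Real.sqrt (a i * b i)) ^ 2

/-- The entries of `a` sorted in non-increasing order, as a vector on `Fin (card α)`. -/
def descSorted {α : Type*} [Fintype α] (a : α → ℝ) : Fin (Fintype.card α) → ℝ :=
  fun i =>
    a ((Fintype.equivFin α).symm
      (Tuple.sort (fun j => -a ((Fintype.equivFin α).symm j)) i))

/-- `headSum a K = ∑_{1 ≤ i ≤ K} a^↓_i` (1-based indices `i`, comparison `(i : ℝ) ≤ K`,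
equivalently `i ≤ ⌊K⌋`). -/
def headSum {α : Type*} [Fintype α] (a : α → ℝ) (K : ℝ) : ℝ :=
  ∑ i ∈ Finset.univ.filter (fun i : Fin (Fintype.card α) => ((i : ℕ) + 1 : ℝ) ≤ K),
    descSorted a i

/-- `tailSum a K = ∑_{i ≥ K} a^↓_i` (1-based indices `i`, comparison `K ≤ (i : ℝ)`,
equivalently `i ≥ ⌈K⌉`). -/
def tailSum {α : Type*} [Fintype α] (a : α → ℝ) (K : ℝ) : ℝ :=
  ∑ i ∈ Finset.univ.filter (fun i : Fin (Fintype.card α) => K ≤ ((i : ℕ) + 1 : ℝ)),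
    descSorted a i

/-- `a` majorises `b` (written `a ≻ b`): every partial sum of the non-increasingly sorted
`a` dominates the corresponding partial sum of sorted `b` (shorter vectors padded with zeros). -/
def Maj {α β : Type*} [Fintype α] [Fintype β] (a : α → ℝ) (b : β → ℝ) : Prop :=
  ∀ j : ℕ, headSum b (j : ℝ) ≤ headSum a (j : ℝ)

/-- `a ≻_ε b`: approximate majorisation (from above) with total variation error:
there is a probability distribution `b̃` with `a ≻ b̃` and `δ(b, b̃) ≤ ε`. -/
def ApproxMajTV {α β : Type*} [Fintype α] [Fintype β] (a : α → ℝ) (b : β → ℝ) (ε : ℝ) : Prop :=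
  ∃ bt : β → ℝ, IsProbDist bt ∧ Maj a bt ∧ tvd b bt ≤ ε

/-- `a ≺_ε b`: approximate majorisation (from below) with total variation error:
there is a probability distribution `b̃` with `a ≺ b̃` and `δ(b, b̃) ≤ ε`. -/
def ApproxSubMajTV {α β : Type*} [Fintype α] [Fintype β] (a : α → ℝ) (b : β → ℝ) (ε : ℝ) : Prop :=
  ∃ bt : β → ℝ, IsProbDist bt ∧ Maj bt a ∧ tvd b bt ≤ ε

/-- A moderate sequence: `t n → 0` and `√n · t n → +∞`. -/
def ModerateSeq (t : ℕ → ℝ) : Prop :=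
  Tendsto t atTop (𝓝 0) ∧ Tendsto (fun n : ℕ => Real.sqrt (n : ℝ) * t n) atTop atTop

/-- The uniform distribution on `Fin d`. -/
def unif (d : ℕ) : Fin d → ℝ := fun _ => 1 / (d : ℝ)

/-- The embedding map `Γ` associated with `γ_i = c_i / N`: for each `i` it produces
`c_i` entries equal to `a_i / c_i`. -/
def embed {d : ℕ} (c : Fin d → ℕ) (a : Fin d → ℝ) : (Σ i : Fin d, Fin (c i)) → ℝ :=
  fun x => a x.1 / (c x.1 : ℝ)

/-- Cut-and-pile modification of the sorted version of `a`, with cut at `K`: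
the first entry absorbs the total mass of entries at (1-based) positions `≥ K`,
entries at positions `1 < i < K` are unchanged, and entries at positions `≥ K` are set to 0. -/
def cutAndPile {α : Type*} [Fintype α] (a : α → ℝ) (K : ℝ) : Fin (Fintype.card α) → ℝ :=
  fun i =>
    if (i : ℕ) = 0 then descSorted a i + tailSum a K
    else if ((i : ℕ) + 1 : ℝ) < K then descSorted a i else 0

theorem exists_equiv_descSorted {α : Type*} [Fintype α] (a : α → ℝ) :
    ∃ e : Fin (Fintype.card α) ≃ α, (∀ i, descSorted a i = a (e i)) ∧
      Antitone (descSorted a) := by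
  refine ⟨(Tuple.sort (fun j => -a ((Fintype.equivFin α).symm j))).trans
    (Fintype.equivFin α).symm, fun i => rfl, fun i j hij => ?_⟩
  have h := Tuple.monotone_sort (fun j => -a ((Fintype.equivFin α).symm j)) hij
  simpa [descSorted] using h

/-- The indices counted by `headSum` form a set of at most `K` elements. -/
theorem card_filter_succ_le {N : ℕ} {K : ℝ} (hK : 0 ≤ K) :
    ((univ.filter (fun i : Fin N => ((i : ℕ) + 1 : ℝ) ≤ K)).card : ℝ) ≤ K := by
  have h1 : (univ.filter (fun i : Fin N => ((i : ℕ) + 1 : ℝ) ≤ K)).card ≤ ⌊K⌋₊ := by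
    calc (univ.filter (fun i : Fin N => ((i : ℕ) + 1 : ℝ) ≤ K)).card
        = ((univ.filter (fun i : Fin N => ((i : ℕ) + 1 : ℝ) ≤ K)).image
            (fun i : Fin N => (i : ℕ))).card :=
          (card_image_of_injective _ Fin.val_injective).symm
      _ ≤ (range ⌊K⌋₊).card := by
          refine card_le_card fun k hk => ?_
          simp only [mem_image, mem_filter, mem_univ, true_and] at hk
          obtain ⟨i, hi, rfl⟩ := hk
          rw [mem_range]
          exact Nat.lt_of_succ_le (Nat.le_floor (by push_cast; exact hi))
      _ = ⌊K⌋₊ := card_range _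
  calc _ ≤ (⌊K⌋₊ : ℝ) := by exact_mod_cast h1
    _ ≤ K := Nat.floor_le hK

theorem exists_finset_headSum {α : Type*} [Fintype α] (a : α → ℝ) {K : ℝ} (hK : 0 ≤ K) :
    ∃ T : Finset α, (T.card : ℝ) ≤ K ∧ headSum a K = ∑ i ∈ T, a i := by
  obtain ⟨e, he, -⟩ := exists_equiv_descSorted a
  refine ⟨(univ.filter (fun i : Fin (Fintype.card α) => ((i : ℕ) + 1 : ℝ) ≤ K)).map
    e.toEmbedding, ?_, ?_⟩
  · rw [card_map]; exact card_filter_succ_le hK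
  · rw [sum_map, headSum]
    exact sum_congr rfl fun i _ => he i

theorem sum_le_sum_filter_of_antitone {N : ℕ} {b : Fin N → ℝ} (hb : Antitone b)
    (h0 : ∀ i, 0 ≤ b i) {K : ℝ} (T : Finset (Fin N)) (hT : (T.card : ℝ) ≤ K) :
    ∑ i ∈ T, b i ≤ ∑ i ∈ univ.filter (fun i : Fin N => ((i : ℕ) + 1 : ℝ) ≤ K), b i := by
  classical
  set A := univ.filter (fun i : Fin N => ((i : ℕ) + 1 : ℝ) ≤ K) with hA
  have hT' : T.card ≤ ⌊K⌋₊ := Nat.le_floor hT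
  have hmem : ∀ i : Fin N, i ∈ A ↔ (i : ℕ) < ⌊K⌋₊ := by
    intro i
    have hK : 0 ≤ K := le_trans (by positivity) hT
    rw [hA, mem_filter, ← Nat.succ_le_iff, Nat.le_floor_iff hK]
    simp
  rcases Nat.lt_or_ge ⌊K⌋₊ N with hN | hN
  · have hcard : A.card = ⌊K⌋₊ := by
      have : A = univ.filter (fun i : Fin N => (i : ℕ) < ⌊K⌋₊) := by
        ext i; simp [hmem]
      rw [this, Fin.card_filter_val_lt, min_eq_right hN.le]
    have hc : (T \ A).card ≤ (A \ T).card := by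
      have h1 := card_sdiff_add_card_inter T A
      have h2 := card_sdiff_add_card_inter A T
      rw [inter_comm] at h2
      omega
    set β := b ⟨⌊K⌋₊, hN⟩
    have hup : ∑ i ∈ T \ A, b i ≤ (T \ A).card * β := by
      rw [← nsmul_eq_mul]
      refine sum_le_card_nsmul _ _ _ fun i hi => hb ?_
      have := (mem_sdiff.1 hi).2
      rw [hmem] at this
      exact Fin.le_def.2 (not_lt.1 this)
    have hlow : (A \ T).card * β ≤ ∑ i ∈ A \ T, b i := by
      rw [← nsmul_eq_mul]
      refine card_nsmul_le_sum _ _ _ fun i hi => hb ?_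
      have := (mem_sdiff.1 hi).1
      rw [hmem] at this
      exact Fin.le_def.2 this.le
    have hmid : ((T \ A).card : ℝ) * β ≤ (A \ T).card * β :=
      mul_le_mul_of_nonneg_right (by exact_mod_cast hc) (h0 _)
    have e1 := sum_inter_add_sum_sdiff T A b
    have e2 := sum_inter_add_sum_sdiff A T b
    rw [inter_comm] at e2
    linarith
  · have : A = univ := by
      ext i; simp only [hmem, mem_univ, iff_true]; exact i.2.trans_le hN
    rw [this]
    exact sum_le_sum_of_subset_of_nonneg (subset_univ _) fun i _ _ => h0 i

theorem sum_le_headSum {α : Type*} [Fintype α] {a : α → ℝ} (h0 : ∀ i, 0 ≤ a i) {K : ℝ}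
    (T : Finset α) (hT : (T.card : ℝ) ≤ K) : ∑ i ∈ T, a i ≤ headSum a K := by
  obtain ⟨e, he, hanti⟩ := exists_equiv_descSorted a
  have h := sum_le_sum_filter_of_antitone hanti (fun i => by rw [he]; exact h0 _)
    (T.map e.symm.toEmbedding) (K := K) (by rwa [card_map])
  rw [sum_map] at h
  refine le_trans (le_of_eq (sum_congr rfl fun i _ => ?_)) h
  simp [he]

theorem headSum_nonneg {α : Type*} [Fintype α] {a : α → ℝ} (h0 : ∀ i, 0 ≤ a i) (K : ℝ) :
    0 ≤ headSum a K := by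
  obtain ⟨e, he, -⟩ := exists_equiv_descSorted a
  exact sum_nonneg fun i _ => by rw [he]; exact h0 _

theorem headSum_le_one {α : Type*} [Fintype α] {a : α → ℝ} (ha : IsProbDist a) {K : ℝ}
    (hK : 0 ≤ K) : headSum a K ≤ 1 := by
  obtain ⟨T, -, hT⟩ := exists_finset_headSum a hK
  rw [hT, ← ha.2]
  exact sum_le_sum_of_subset_of_nonneg (subset_univ _) fun i _ _ => ha.1 i

theorem headSum_mono {α : Type*} [Fintype α] {a : α → ℝ} (h0 : ∀ i, 0 ≤ a i) {K L : ℝ}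
    (hKL : K ≤ L) : headSum a K ≤ headSum a L := by
  obtain ⟨e, he, -⟩ := exists_equiv_descSorted a
  refine sum_le_sum_of_subset_of_nonneg (fun i hi => ?_) fun i _ _ => by rw [he]; exact h0 _
  simp only [mem_filter, mem_univ, true_and] at hi ⊢
  exact hi.trans hKL

theorem headSum_zero {α : Type*} [Fintype α] (a : α → ℝ) : headSum a 0 = 0 := by
  refine sum_eq_zero fun i hi => ?_
  simp only [mem_filter, mem_univ, true_and] at hi
  linarith [Nat.cast_nonneg (α := ℝ) (i : ℕ)]

theorem headSum_floor {α : Type*} [Fintype α] (a : α → ℝ) {K : ℝ} (hK : 0 ≤ K) :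
    headSum a (⌊K⌋₊ : ℝ) = headSum a K := by
  unfold headSum
  congr 1
  ext i
  simp only [mem_filter, mem_univ, true_and]
  have := Nat.le_floor_iff (n := (i : ℕ) + 1) hK
  push_cast at this
  rw [← this]
  exact_mod_cast Iff.rfl

theorem headSum_tensor_le {α β : Type*} [Fintype α] [Fintype β] {a : α → ℝ} {b : β → ℝ}
    (ha : ∀ i, 0 ≤ a i) (hb : IsProbDist b) {K : ℝ} (hK : 0 ≤ K) :
    headSum (tensor a b) K ≤ headSum a K := by
  classical
  obtain ⟨T, hT, hsum⟩ := exists_finset_headSum (tensor a b) hK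
  rw [hsum, ← sum_fiberwise T Prod.snd]
  calc ∑ y, ∑ x ∈ T with x.2 = y, tensor a b x
      ≤ ∑ y, b y * headSum a K := by
        refine sum_le_sum fun y _ => ?_
        have hinj : Set.InjOn Prod.fst ((T.filter fun x => x.2 = y : Finset (α × β)) : Set (α × β)) := by
          rintro ⟨x, y'⟩ hx ⟨x', y''⟩ hx' h
          simp only [coe_filter, Set.mem_ofPred_eq] at hx hx'
          ext <;> simp_all
        have h1 := sum_le_headSum ha (K := K) ((T.filter fun x => x.2 = y).image Prod.fst)
          (le_trans (by exact_mod_cast card_image_le.trans (card_filter_le _ _)) hT)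
        rw [sum_image hinj] at h1
        calc ∑ x ∈ T with x.2 = y, tensor a b x
            = b y * ∑ x ∈ T with x.2 = y, a x.1 := by
              rw [mul_sum]
              refine sum_congr rfl fun x hx => ?_
              rw [tensor, (mem_filter.1 hx).2, mul_comm]
          _ ≤ _ := mul_le_mul_of_nonneg_left h1 (hb.1 y)
    _ = headSum a K := by rw [← sum_mul, hb.2, one_mul]

theorem IsSharp.isProbDist {α : Type*} [Fintype α] {a : α → ℝ} (h : IsSharp a) :
    IsProbDist a := by
  classical
  obtain ⟨i, hi, hj⟩ := h
  refine ⟨fun j => ?_, ?_⟩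
  · by_cases hji : j = i
    · rw [hji, hi]; exact zero_le_one
    · rw [hj j hji]
  · rw [sum_eq_single i (fun j _ hji => hj j hji) (fun h => (h (mem_univ _)).elim), hi]

theorem headSum_tensor_sharp {α β : Type*} [Fintype α] [Fintype β] {a : α → ℝ} {b : β → ℝ}
    (ha : ∀ i, 0 ≤ a i) (hb : IsSharp b) {K : ℝ} (hK : 0 ≤ K) :
    headSum (tensor a b) K = headSum a K := by
  refine le_antisymm (headSum_tensor_le ha hb.isProbDist hK) ?_
  obtain ⟨T, hT, hsum⟩ := exists_finset_headSum a hK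
  have hb0 := hb.isProbDist.1
  obtain ⟨y, hy, -⟩ := hb
  have h := sum_le_headSum (a := tensor a b) (fun x => mul_nonneg (ha _) (hb0 _)) (K := K)
    (T.map ⟨fun x => (x, y), fun x x' h => congrArg Prod.fst h⟩) (by rwa [card_map])
  rw [sum_map] at h
  refine le_trans (le_of_eq ?_) h
  rw [hsum]
  refine sum_congr rfl fun x _ => ?_
  change a x = a x * b y
  rw [hy, mul_one]

theorem IsSharp.tpow {α : Type*} [Fintype α] {a : α → ℝ} (h : IsSharp a) (n : ℕ) :
    IsSharp (tpow a n) := by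
  obtain ⟨i, hi, hj⟩ := h
  refine ⟨fun _ => i, by simp [_root_.tpow, hi], fun f hf => ?_⟩
  obtain ⟨k, hk⟩ := Function.ne_iff.1 hf
  exact prod_eq_zero (mem_univ k) (hj _ hk)

theorem sum_tpow {α : Type*} [Fintype α] (a : α → ℝ) (n : ℕ) :
    ∑ f, tpow a n f = (∑ i, a i) ^ n := by
  classical
  exact (Fintype.sum_pow a n).symm

theorem IsProbDist.tpow {α : Type*} [Fintype α] {a : α → ℝ} (h : IsProbDist a) (n : ℕ) :
    IsProbDist (tpow a n) :=
  ⟨fun f => prod_nonneg fun j _ => h.1 (f j), by rw [sum_tpow, h.2, one_pow]⟩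

theorem IsProbDist.tensor {α β : Type*} [Fintype α] [Fintype β] {a : α → ℝ} {b : β → ℝ}
    (ha : IsProbDist a) (hb : IsProbDist b) : IsProbDist (tensor a b) := by
  refine ⟨fun x => mul_nonneg (ha.1 _) (hb.1 _), ?_⟩
  rw [Fintype.sum_prod_type]
  simp only [_root_.tensor, ← mul_sum, hb.2, mul_one, ha.2]

theorem headSum_tpow_succ_le {α : Type*} [Fintype α] {a : α → ℝ} (ha : IsProbDist a) (m : ℕ)
    {K : ℝ} (hK : 0 ≤ K) : headSum (tpow a (m + 1)) K ≤ headSum (tpow a m) K := by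
  classical
  obtain ⟨T, hT, hsum⟩ := exists_finset_headSum (tpow a (m + 1)) hK
  refine le_trans ?_ (headSum_tensor_le (ha.tpow m).1 ha hK)
  have h := sum_le_headSum (a := tensor (tpow a m) a)
    (fun x => mul_nonneg ((ha.tpow m).1 _) (ha.1 _)) (K := K)
    (T.map ⟨fun f => (Fin.tail f, f 0), fun f g h => by
      rw [← Fin.cons_self_tail f, ← Fin.cons_self_tail g]
      simp only [Prod.mk.injEq] at h
      rw [h.1, h.2]⟩) (by rwa [card_map])
  rw [sum_map] at h
  refine le_trans (le_of_eq ?_) h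
  rw [hsum]
  refine sum_congr rfl fun f _ => ?_
  change ∏ j, a (f j) = (∏ j, a (Fin.tail f j)) * a (f 0)
  rw [Fin.prod_univ_succ, mul_comm]
  rfl

theorem headSum_tpow_antitone {α : Type*} [Fintype α] {a : α → ℝ} (ha : IsProbDist a)
    {K : ℝ} (hK : 0 ≤ K) : Antitone fun m => headSum (tpow a m) K :=
  antitone_nat_of_succ_le fun m => headSum_tpow_succ_le ha m hK

theorem sum_sub_le_tvd {α : Type*} [Fintype α] {a b : α → ℝ} (ha : IsProbDist a)
    (hb : IsProbDist b) (T : Finset α) : ∑ i ∈ T, b i ≤ ∑ i ∈ T, a i + tvd a b := by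
  classical
  have h1 : ∑ i ∈ T, (b i - a i) ≤ ∑ i ∈ T, |a i - b i| :=
    sum_le_sum fun i _ => by rw [abs_sub_comm]; exact le_abs_self _
  have h2 : ∑ i ∈ Tᶜ, (a i - b i) ≤ ∑ i ∈ Tᶜ, |a i - b i| :=
    sum_le_sum fun i _ => le_abs_self _
  have e1 := sum_add_sum_compl T a
  have e2 := sum_add_sum_compl T b
  have e3 := sum_add_sum_compl T fun i => |a i - b i|
  rw [sum_sub_distrib] at h1 h2
  rw [ha.2] at e1
  rw [hb.2] at e2
  unfold tvd
  linarith

theorem headSum_succ {α : Type*} [Fintype α] (a : α → ℝ) (k : Fin (Fintype.card α)) :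
    headSum a (((k : ℕ) + 1 : ℕ) : ℝ) = headSum a ((k : ℕ) : ℝ) + descSorted a k := by
  classical
  unfold headSum
  have : (univ.filter fun i : Fin (Fintype.card α) =>
        ((i : ℕ) + 1 : ℝ) ≤ (((k : ℕ) + 1 : ℕ) : ℝ)) =
      insert k (univ.filter fun i : Fin (Fintype.card α) => ((i : ℕ) + 1 : ℝ) ≤ ((k : ℕ) : ℝ)) := by
    ext i
    simp only [mem_filter, mem_univ, true_and, mem_insert, Fin.ext_iff]
    norm_cast
    omega
  rw [this, sum_insert, add_comm]
  simp only [mem_filter, mem_univ, true_and, not_le]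
  linarith

theorem headSum_of_card_le {α : Type*} [Fintype α] {a : α → ℝ} (ha : IsProbDist a) {K : ℝ}
    (hK : (Fintype.card α : ℝ) ≤ K) : headSum a K = 1 := by
  refine le_antisymm (headSum_le_one ha (le_trans (Nat.cast_nonneg _) hK)) ?_
  rw [← ha.2]
  exact sum_le_headSum ha.1 univ (by rwa [card_univ])

/-- The cumulative sums of `b`, shifted up by `ε` and capped at one. -/
def liftedHead {α : Type*} [Fintype α] (b : α → ℝ) (ε : ℝ) (k : ℕ) : ℝ :=
  if k = 0 then 0 else min 1 (headSum b (k : ℝ) + ε)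

/-- Moving mass `ε` from the tail of `b` onto its largest entry dominates every distribution
whose partial sums exceed those of `b` by at most `ε`. -/
theorem exists_lifted {α : Type*} [Fintype α] {b : α → ℝ} (hb : IsProbDist b) {ε : ℝ}
    (hε : 0 ≤ ε) : ∃ bt : α → ℝ, IsProbDist bt ∧ tvd b bt ≤ ε ∧
      ∀ k : ℕ, 1 ≤ k → min 1 (headSum b (k : ℝ) + ε) ≤ headSum bt (k : ℝ) := by
  classical
  obtain ⟨e, he, -⟩ := exists_equiv_descSorted b
  have hN : 0 < Fintype.card α := by
    rw [Fintype.card_pos_iff]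
    by_contra h
    rw [not_nonempty_iff] at h
    simpa using hb.2
  set c : Fin (Fintype.card α) → ℝ := fun k => liftedHead b ε (k + 1) - liftedHead b ε k with hc
  have hc0 : ∀ k, 0 ≤ c k := by
    intro k
    simp only [hc, liftedHead, Nat.add_eq_zero_iff, one_ne_zero, and_false, if_false, sub_nonneg]
    split_ifs with hk
    · exact le_min zero_le_one (add_nonneg (headSum_nonneg hb.1 _) hε)
    · gcongr
      refine headSum_mono hb.1 ?_
      push_cast; linarith
  have hcle : ∀ k : Fin (Fintype.card α), (k : ℕ) ≠ 0 → c k ≤ descSorted b k := by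
    intro k hk
    simp only [hc, liftedHead, Nat.add_eq_zero_iff, one_ne_zero, and_false, if_false, hk]
    have h1 := headSum_succ b k
    have h2 : 0 ≤ descSorted b k := by rw [he]; exact hb.1 _
    rw [h1]
    rcases le_total 1 (headSum b ((k : ℕ) : ℝ) + ε) with h | h
    · rw [min_eq_left h]
      have := min_le_left 1 (headSum b ((k : ℕ) : ℝ) + descSorted b k + ε)
      linarith
    · rw [min_eq_right h]
      have := min_le_right 1 (headSum b ((k : ℕ) : ℝ) + descSorted b k + ε)
      linarith
  have hc1 : c ⟨0, hN⟩ ≤ descSorted b ⟨0, hN⟩ + ε := by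
    have h1 := headSum_succ b ⟨0, hN⟩
    simp only [zero_add, Nat.cast_one, Nat.cast_zero, headSum_zero] at h1
    simp only [hc, liftedHead, zero_add, one_ne_zero, if_false, if_true, Nat.cast_one, sub_zero]
    rw [h1]
    exact min_le_right _ _
  have htel : ∀ k : ℕ, k ≤ (Fintype.card α) →
      ∑ i ∈ univ.filter (fun i : Fin (Fintype.card α) => (i : ℕ) < k), c i = liftedHead b ε k := by
    intro k
    induction k with
    | zero => intro _; simp [liftedHead]
    | succ k ih =>
      intro hk
      have : (univ.filter fun i : Fin (Fintype.card α) => (i : ℕ) < k + 1) =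
          insert ⟨k, hk⟩ (univ.filter fun i : Fin (Fintype.card α) => (i : ℕ) < k) := by
        ext i
        simp only [mem_filter, mem_univ, true_and, mem_insert, Fin.ext_iff]
        omega
      rw [this, sum_insert (by simp), ih (by omega)]
      simp [hc]
  have hlN : liftedHead b ε (Fintype.card α) = 1 := by
    rw [liftedHead, if_neg hN.ne', headSum_of_card_le hb (le_of_eq rfl)]
    exact min_eq_left (by linarith)
  have hsumc : ∑ i, c i = 1 := by
    rw [← hlN, ← htel (Fintype.card α) le_rfl]
    refine sum_congr ?_ fun _ _ => rfl
    ext i; simp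
  have hbt : IsProbDist fun x => c (e.symm x) := by
    refine ⟨fun x => hc0 _, ?_⟩
    rw [← hsumc]
    exact Equiv.sum_comp e.symm c
  refine ⟨fun x => c (e.symm x), hbt, ?_, ?_⟩
  · have hsum : ∑ x, (b x - c (e.symm x)) = 0 := by
      rw [sum_sub_distrib, hb.2, hbt.2, sub_self]
    have habs : ∀ y : ℝ, |y| = y + 2 * max 0 (-y) := by
      intro y
      rcases le_total 0 y with h | h
      · rw [abs_of_nonneg h, max_eq_left (by linarith)]; ring
      · rw [abs_of_nonpos h, max_eq_right (by linarith)]; ring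
    have h2 : tvd b (fun x => c (e.symm x)) = ∑ x, max 0 (c (e.symm x) - b x) := by
      unfold tvd
      simp only [habs, neg_sub]
      rw [sum_add_distrib, hsum, ← mul_sum]
      ring
    rw [h2, sum_eq_single (e ⟨0, hN⟩)]
    · rw [← he, Equiv.symm_apply_apply]
      exact max_le hε (by linarith)
    · intro x _ hx
      refine max_eq_left ?_
      have hne : ((e.symm x : Fin (Fintype.card α)) : ℕ) ≠ 0 := fun h => hx (by
        have : e.symm x = ⟨0, hN⟩ := Fin.ext h
        rw [← this, Equiv.apply_symm_apply])
      have := hcle _ hne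
      rw [he, Equiv.apply_symm_apply] at this
      linarith
    · intro h; exact (h (mem_univ _)).elim
  · intro k hk
    rcases le_total k (Fintype.card α) with hkN | hkN
    · have h := sum_le_headSum hbt.1 (K := (k : ℝ))
        ((univ.filter fun i : Fin (Fintype.card α) => (i : ℕ) < k).map e.toEmbedding)
        (by rw [card_map, Fin.card_filter_val_lt, min_eq_right hkN])
      rw [sum_map] at h
      simp only [Equiv.coe_toEmbedding, Equiv.symm_apply_apply] at h
      rw [htel k hkN, liftedHead, if_neg (by omega)] at h
      exact h
    · rw [headSum_of_card_le hbt (by exact_mod_cast hkN)]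
      exact min_le_left _ _

theorem approxSubMajTV_iff {α β : Type*} [Fintype α] [Fintype β] {a : α → ℝ} {b : β → ℝ}
    (ha : IsProbDist a) (hb : IsProbDist b) {ε : ℝ} (hε : 0 ≤ ε) :
    ApproxSubMajTV a b ε ↔ ∀ j : ℕ, headSum a (j : ℝ) ≤ headSum b (j : ℝ) + ε := by
  constructor
  · rintro ⟨bt, hbt, hmaj, htv⟩ j
    obtain ⟨T, hT, hsum⟩ := exists_finset_headSum bt (Nat.cast_nonneg (α := ℝ) j)
    have h1 := sum_sub_le_tvd hb hbt T
    have h2 := sum_le_headSum hb.1 T hT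
    have h3 := hmaj j
    linarith
  · intro h
    obtain ⟨bt, hbt, htv, hhead⟩ := exists_lifted hb hε
    refine ⟨bt, hbt, fun j => ?_, htv⟩
    rcases Nat.eq_zero_or_pos j with rfl | hj
    · simp [headSum_zero]
    · exact le_trans (le_min (headSum_le_one ha (Nat.cast_nonneg _)) (h j)) (hhead j hj)

theorem approxSubMajTV_tensor_iff {dp dq ds : ℕ} {p : Fin dp → ℝ} {q : Fin dq → ℝ}
    {s : Fin ds → ℝ} (hp : IsProbDist p) (hq : IsProbDist q) (hs : IsSharp s) (n m : ℕ)
    {ε : ℝ} (hε : 0 ≤ ε) :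
    ApproxSubMajTV (tensor (tpow p n) (tpow s m)) (tensor (tpow q m) (tpow s n)) ε ↔
      ∀ j : ℕ, headSum (tpow p n) (j : ℝ) ≤ headSum (tpow q m) (j : ℝ) + ε := by
  rw [approxSubMajTV_iff ((hp.tpow n).tensor (hs.tpow m).isProbDist)
    ((hq.tpow m).tensor (hs.tpow n).isProbDist) hε]
  refine forall_congr' fun j => ?_
  rw [headSum_tensor_sharp (hp.tpow n).1 (hs.tpow m) (Nat.cast_nonneg _),
    headSum_tensor_sharp (hq.tpow m).1 (hs.tpow n) (Nat.cast_nonneg _)]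

/-- The moment generating functions of `Y n` under the weights `w n` are asymptotically Gaussian
with variance `v ^ 2 / 2` on the exponential scale `E n`. -/
def HasGaussianMgf {Ω : ℕ → Type*} [∀ n, Fintype (Ω n)] (w Y : ∀ n, Ω n → ℝ) (E : ℕ → ℝ)
    (v : ℝ) : Prop :=
  ∀ l γ : ℝ, 0 < γ → ∀ᶠ n in atTop,
    Real.exp (E n * (l ^ 2 * v ^ 2 / 4 - γ)) ≤ ∑ ω, w n ω * Real.exp (l * E n * Y n ω) ∧
    ∑ ω, w n ω * Real.exp (l * E n * Y n ω) ≤ Real.exp (E n * (l ^ 2 * v ^ 2 / 4 + γ))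

theorem HasGaussianMgf.neg {Ω : ℕ → Type*} [∀ n, Fintype (Ω n)] {w Y : ∀ n, Ω n → ℝ}
    {E : ℕ → ℝ} {v : ℝ} (h : HasGaussianMgf w Y E v) :
    HasGaussianMgf w (fun n ω => -Y n ω) E v := by
  intro l γ hγ
  filter_upwards [h (-l) γ hγ] with n hn
  simpa [mul_assoc] using hn

theorem HasGaussianMgf.sum_tail_le {Ω : ℕ → Type*} [∀ n, Fintype (Ω n)] {w Y : ∀ n, Ω n → ℝ}
    {E : ℕ → ℝ} {v : ℝ} (h : HasGaussianMgf w Y E v) (hw : ∀ n ω, 0 ≤ w n ω)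
    (hE : Tendsto E atTop atTop) (hv : 0 < v) {x c : ℝ} (hx : 0 < x) (hc : c < (x / v) ^ 2) :
    ∀ᶠ n in atTop, ∑ ω with x ≤ Y n ω, w n ω ≤ Real.exp (-(c * E n)) := by
  have hl : 0 < 2 * x / v ^ 2 := by positivity
  filter_upwards [h (2 * x / v ^ 2) ((x / v) ^ 2 - c) (by linarith),
    hE.eventually_ge_atTop 0] with n hn hE0
  have h1 : ∑ ω with x ≤ Y n ω, w n ω * Real.exp (2 * x / v ^ 2 * E n * x) ≤
      ∑ ω, w n ω * Real.exp (2 * x / v ^ 2 * E n * Y n ω) := by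
    refine le_trans (sum_le_sum fun ω hω => ?_) (sum_le_sum_of_subset_of_nonneg (filter_subset _ _)
      fun ω _ _ => mul_nonneg (hw n ω) (Real.exp_pos _).le)
    have := (mem_filter.1 hω).2
    have := hw n ω
    gcongr
  rw [← sum_mul] at h1
  have h2 := h1.trans hn.2
  rw [← le_div_iff₀ (Real.exp_pos _), ← Real.exp_sub] at h2
  refine h2.trans (le_of_eq ?_)
  congr 1
  field_simp
  ring

/-- Localising an exponential moment to `x ≤ Y ≤ y`, the complement being controlled by
exponential moments at nearby parameters. -/
theorem sum_mul_exp_le {Ω : Type*} [Fintype Ω] {w Y : Ω → ℝ} (hw : ∀ ω, 0 ≤ w ω) {L S : ℝ}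
    (hL : 0 ≤ L) (hS : 0 ≤ S) (x y : ℝ) :
    ∑ ω, w ω * Real.exp (L * Y ω) ≤
      Real.exp (S * x) * ∑ ω, w ω * Real.exp ((L - S) * Y ω) +
      Real.exp (-(S * y)) * ∑ ω, w ω * Real.exp ((L + S) * Y ω) +
      Real.exp (L * y) * ∑ ω with x ≤ Y ω, w ω := by
  rw [sum_filter, mul_sum, mul_sum, mul_sum, ← sum_add_distrib, ← sum_add_distrib]
  refine sum_le_sum fun ω _ => ?_
  have hwn := hw ω
  have e1 : Real.exp (S * x) * (w ω * Real.exp ((L - S) * Y ω)) =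
      w ω * Real.exp (L * Y ω + S * (x - Y ω)) := by
    rw [mul_left_comm, ← Real.exp_add]; ring_nf
  have e2 : Real.exp (-(S * y)) * (w ω * Real.exp ((L + S) * Y ω)) =
      w ω * Real.exp (L * Y ω + S * (Y ω - y)) := by
    rw [mul_left_comm, ← Real.exp_add]; ring_nf
  have p1 : 0 ≤ w ω * Real.exp (L * Y ω + S * (x - Y ω)) := by positivity
  have p2 : 0 ≤ w ω * Real.exp (L * Y ω + S * (Y ω - y)) := by positivity
  have p3 : 0 ≤ Real.exp (L * y) * (if x ≤ Y ω then w ω else 0) := by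
    split_ifs <;> positivity
  rw [e1, e2]
  rcases lt_or_ge (Y ω) x with hY | hY
  · have : w ω * Real.exp (L * Y ω) ≤ w ω * Real.exp (L * Y ω + S * (x - Y ω)) := by
      gcongr
      exact le_add_of_nonneg_right (mul_nonneg hS (sub_nonneg.2 hY.le))
    linarith
  · rcases lt_or_ge y (Y ω) with hY2 | hY2
    · have : w ω * Real.exp (L * Y ω) ≤ w ω * Real.exp (L * Y ω + S * (Y ω - y)) := by
        gcongr
        exact le_add_of_nonneg_right (mul_nonneg hS (sub_nonneg.2 hY2.le))
      linarith
    · have : w ω * Real.exp (L * Y ω) ≤ Real.exp (L * y) * w ω := by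
        rw [mul_comm]
        gcongr
      rw [if_pos hY]
      linarith

theorem HasGaussianMgf.le_sum_tail {Ω : ℕ → Type*} [∀ n, Fintype (Ω n)] {w Y : ∀ n, Ω n → ℝ}
    {E : ℕ → ℝ} {v : ℝ} (h : HasGaussianMgf w Y E v) (hw : ∀ n ω, 0 ≤ w n ω)
    (hE : Tendsto E atTop atTop) (hv : 0 < v) {x c : ℝ} (hx : 0 < x) (hc : (x / v) ^ 2 < c) :
    ∀ᶠ n in atTop, Real.exp (-(c * E n)) ≤ ∑ ω with x ≤ Y n ω, w n ω := by
  obtain ⟨δ, hδ, hδc⟩ : ∃ δ : ℝ, 0 < δ ∧ ((x + δ) / v) ^ 2 + 2 * (x + δ) * δ / v ^ 2 < c := by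
    have hcont : Tendsto (fun δ : ℝ => ((x + δ) / v) ^ 2 + 2 * (x + δ) * δ / v ^ 2)
        (𝓝[>] 0) (𝓝 (((x + 0) / v) ^ 2 + 2 * (x + 0) * 0 / v ^ 2)) := by
      refine Tendsto.mono_left (Continuous.tendsto ?_ 0) nhdsWithin_le_nhds
      fun_prop
    have := (hcont.eventually (gt_mem_nhds (by simpa using hc))).and self_mem_nhdsWithin
    obtain ⟨δ, h1, h2⟩ := this.exists
    exact ⟨δ, h2, h1⟩
  set l := 2 * (x + δ) / v ^ 2 with hl
  set s := 2 * δ / v ^ 2 with hs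
  have hl0 : 0 < l := by positivity
  have hs0 : 0 < s := by positivity
  obtain ⟨γ, hγ, hγ1, hγ2⟩ : ∃ γ : ℝ, 0 < γ ∧
      ((x + δ) / v) ^ 2 + 2 * (x + δ) * δ / v ^ 2 + 2 * γ < c ∧ 4 * γ < (δ / v) ^ 2 := by
    have hd : 0 < (δ / v) ^ 2 := by positivity
    refine ⟨min ((c - (((x + δ) / v) ^ 2 + 2 * (x + δ) * δ / v ^ 2)) / 4) ((δ / v) ^ 2 / 8),
      lt_min (by linarith) (by linarith), ?_, ?_⟩
    · have := min_le_left ((c - (((x + δ) / v) ^ 2 + 2 * (x + δ) * δ / v ^ 2)) / 4) ((δ / v) ^ 2 / 8)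
      linarith
    · have := min_le_right ((c - (((x + δ) / v) ^ 2 + 2 * (x + δ) * δ / v ^ 2)) / 4) ((δ / v) ^ 2 / 8)
      linarith
  have hbig : ∀ᶠ n in atTop, Real.log 4 / γ ≤ E n := hE.eventually_ge_atTop _
  filter_upwards [h l γ hγ, h (l - s) γ hγ, h (l + s) γ hγ, hE.eventually_ge_atTop 0, hbig]
    with n h0 h1 h2 hE0 hEγ
  rw [div_le_iff₀ hγ] at hEγ
  have hsum := sum_mul_exp_le (hw n) (Y := Y n) (mul_nonneg hl0.le hE0) (mul_nonneg hs0.le hE0)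
    x (x + 2 * δ)
  rw [← sub_mul, ← add_mul] at hsum
  set P := ∑ ω with x ≤ Y n ω, w n ω
  have hA : Real.exp (s * E n * x) * ∑ ω, w n ω * Real.exp ((l - s) * E n * Y n ω) ≤
      Real.exp (E n * (l ^ 2 * v ^ 2 / 4 - 3 * γ)) := by
    refine (mul_le_mul_of_nonneg_left h1.2 (Real.exp_pos _).le).trans ?_
    rw [← Real.exp_add, Real.exp_le_exp, mul_right_comm, mul_comm _ (E n), ← mul_add]
    refine mul_le_mul_of_nonneg_left ?_ hE0
    have : s * x + ((l - s) ^ 2 * v ^ 2 / 4) = l ^ 2 * v ^ 2 / 4 - (δ / v) ^ 2 := by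
      rw [hl, hs]; field_simp; ring
    linarith
  have hB : Real.exp (-(s * E n * (x + 2 * δ))) *
      ∑ ω, w n ω * Real.exp ((l + s) * E n * Y n ω) ≤
      Real.exp (E n * (l ^ 2 * v ^ 2 / 4 - 3 * γ)) := by
    refine (mul_le_mul_of_nonneg_left h2.2 (Real.exp_pos _).le).trans ?_
    rw [← Real.exp_add, Real.exp_le_exp, mul_right_comm, mul_comm _ (E n), ← mul_neg, ← mul_add]
    refine mul_le_mul_of_nonneg_left ?_ hE0
    have : -(s * (x + 2 * δ)) + ((l + s) ^ 2 * v ^ 2 / 4) = l ^ 2 * v ^ 2 / 4 - (δ / v) ^ 2 := by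
      rw [hl, hs]; field_simp; ring
    linarith
  have h4 : ∀ y : ℝ, 4 * Real.exp (E n * (y - γ)) ≤ Real.exp (E n * y) := by
    intro y
    have : (4 : ℝ) = Real.exp (Real.log 4) := (Real.exp_log (by norm_num)).symm
    rw [this, ← Real.exp_add, Real.exp_le_exp, mul_sub]
    linarith
  have hC := h4 (l ^ 2 * v ^ 2 / 4 - γ)
  have hD := h4 (l ^ 2 * v ^ 2 / 4 - γ - γ)
  have hD' : Real.exp (E n * (l ^ 2 * v ^ 2 / 4 - γ - γ - γ)) =
    Real.exp (E n * (l ^ 2 * v ^ 2 / 4 - 3 * γ)) := by ring_nf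
  have hpos := Real.exp_pos (E n * (l ^ 2 * v ^ 2 / 4 - γ - γ))
  have hP : Real.exp (E n * (l ^ 2 * v ^ 2 / 4 - γ - γ)) ≤ Real.exp (l * E n * (x + 2 * δ)) * P := by
    linarith [h0.1]
  rw [← div_le_iff₀' (Real.exp_pos _), ← Real.exp_sub] at hP
  refine le_trans ?_ hP
  rw [Real.exp_le_exp]
  have : l ^ 2 * v ^ 2 / 4 - l * (x + 2 * δ) =
      -(((x + δ) / v) ^ 2 + 2 * (x + δ) * δ / v ^ 2) := by
    rw [hl]; field_simp; ring
  rw [mul_right_comm, mul_comm _ (E n), mul_comm (l * (x + 2 * δ)), ← mul_sub,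
    ← mul_neg]
  exact mul_le_mul_of_nonneg_left (by linarith) hE0

/-- Second-order expansion at zero of the moment generating function of a centred random variable
on a finite probability space. -/
theorem eventually_mgf_bounds {α : Type*} [Fintype α] {p : α → ℝ} (hp : IsProbDist p)
    {X : α → ℝ} {V : ℝ} (hX : ∑ i, p i * X i = 0) (hV : ∑ i, p i * X i ^ 2 = V) {γ : ℝ}
    (hγ : 0 < γ) : ∀ᶠ θ in 𝓝 (0 : ℝ),
      Real.exp (θ ^ 2 * (V / 2 - γ)) ≤ ∑ i, p i * Real.exp (θ * X i) ∧
      ∑ i, p i * Real.exp (θ * X i) ≤ Real.exp (θ ^ 2 * (V / 2 + γ)) := by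
  set B := ∑ i, p i * |X i| ^ 3 with hB
  have hsmall : ∀ᶠ θ in 𝓝 (0 : ℝ), ∀ i, |θ * X i| ≤ 1 := by
    rw [eventually_all]
    intro i
    have : Tendsto (fun θ : ℝ => |θ * X i|) (𝓝 0) (𝓝 |0 * X i|) := by
      refine Continuous.tendsto ?_ 0
      fun_prop
    exact this.eventually (ge_mem_nhds (by simp))
  have hB' : ∀ᶠ θ in 𝓝 (0 : ℝ), |θ| * B < γ / 2 := by
    have : Tendsto (fun θ : ℝ => |θ| * B) (𝓝 0) (𝓝 (|0| * B)) := by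
      refine Continuous.tendsto ?_ 0
      fun_prop
    exact this.eventually (gt_mem_nhds (by simp; linarith))
  have hy1 : ∀ᶠ θ in 𝓝 (0 : ℝ), |θ ^ 2 * (V / 2 - γ)| < 1 := by
    have : Tendsto (fun θ : ℝ => |θ ^ 2 * (V / 2 - γ)|) (𝓝 0) (𝓝 |0 ^ 2 * (V / 2 - γ)|) := by
      refine Continuous.tendsto ?_ 0
      fun_prop
    exact this.eventually (gt_mem_nhds (by simp))
  have hy2 : ∀ᶠ θ in 𝓝 (0 : ℝ), θ ^ 2 * (V / 2 - γ) ^ 2 < γ / 2 := by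
    have : Tendsto (fun θ : ℝ => θ ^ 2 * (V / 2 - γ) ^ 2) (𝓝 0)
        (𝓝 (0 ^ 2 * (V / 2 - γ) ^ 2)) := by
      refine Continuous.tendsto ?_ 0
      fun_prop
    exact this.eventually (gt_mem_nhds (by simp; linarith))
  filter_upwards [hsmall, hB', hy1, hy2] with θ h1 h2 h3 h4
  have hterm : ∀ i, |p i * Real.exp (θ * X i) - p i * (1 + θ * X i + (θ * X i) ^ 2 / 2)| ≤
      |θ| ^ 3 * (p i * |X i| ^ 3) := by
    intro i
    have h := Real.exp_bound (h1 i) (n := 3) (by norm_num)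
    simp only [sum_range_succ, range_zero, sum_empty, Nat.factorial] at h
    norm_num at h
    rw [← mul_sub, abs_mul, abs_of_nonneg (hp.1 i)]
    calc p i * |Real.exp (θ * X i) - (1 + θ * X i + (θ * X i) ^ 2 / 2)|
        ≤ p i * |θ * X i| ^ 3 := by
          refine mul_le_mul_of_nonneg_left ?_ (hp.1 i)
          have h0 : 0 ≤ |θ * X i| ^ 3 := by positivity
          rw [abs_mul] at h0 ⊢
          linarith
      _ = |θ| ^ 3 * (p i * |X i| ^ 3) := by rw [abs_mul]; ring
  have hmain : |∑ i, p i * Real.exp (θ * X i) - (1 + θ ^ 2 * (V / 2))| ≤ θ ^ 2 * (γ / 2) := by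
    have hexp : ∑ i, p i * (1 + θ * X i + (θ * X i) ^ 2 / 2) = 1 + θ ^ 2 * (V / 2) := by
      have : ∀ i, p i * (1 + θ * X i + (θ * X i) ^ 2 / 2) =
          p i + θ * (p i * X i) + θ ^ 2 / 2 * (p i * X i ^ 2) := fun i => by ring
      simp only [this, sum_add_distrib, ← mul_sum, hp.2, hX, hV]
      ring
    rw [← hexp, ← sum_sub_distrib]
    refine (abs_sum_le_sum_abs _ _).trans ((sum_le_sum fun i _ => hterm i).trans ?_)
    rw [← mul_sum, ← hB]
    calc |θ| ^ 3 * B = θ ^ 2 * (|θ| * B) := by rw [← sq_abs θ]; ring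
      _ ≤ _ := mul_le_mul_of_nonneg_left h2.le (sq_nonneg θ)
  rw [abs_le] at hmain
  have hθ := sq_nonneg θ
  constructor
  · have h5 := Real.abs_exp_sub_one_sub_id_le h3.le
    have h6 : (θ ^ 2 * (V / 2 - γ)) ^ 2 ≤ θ ^ 2 * (γ / 2) := by
      calc (θ ^ 2 * (V / 2 - γ)) ^ 2 = θ ^ 2 * (θ ^ 2 * (V / 2 - γ) ^ 2) := by ring
        _ ≤ _ := mul_le_mul_of_nonneg_left h4.le hθ
    have h7 := (abs_le.1 h5).2
    have h8 : θ ^ 2 * (V / 2 - γ) = θ ^ 2 * (V / 2) - 2 * (θ ^ 2 * (γ / 2)) := by ring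
    linarith [hmain.1]
  · have h5 := Real.add_one_le_exp (θ ^ 2 * (V / 2 + γ))
    have h8 : θ ^ 2 * (V / 2 + γ) = θ ^ 2 * (V / 2) + 2 * (θ ^ 2 * (γ / 2)) := by ring
    have h9 : 0 ≤ θ ^ 2 * (γ / 2) := by positivity
    linarith [hmain.2]

/-- The centred surprisal of `a`. -/
def surprisal {α : Type*} [Fintype α] (a : α → ℝ) (i : α) : ℝ :=
  -Real.log (a i) - shannonH a

theorem sum_mul_surprisal {α : Type*} [Fintype α] {a : α → ℝ} (ha : IsProbDist a) :
    ∑ i, a i * surprisal a i = 0 := by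
  simp only [surprisal, mul_sub, sum_sub_distrib, ← sum_mul, ha.2, mul_neg, sum_neg_distrib]
  unfold shannonH
  ring

theorem sum_mul_surprisal_sq {α : Type*} [Fintype α] (a : α → ℝ) :
    ∑ i, a i * surprisal a i ^ 2 = entV a := by
  refine sum_congr rfl fun i _ => ?_
  rw [surprisal]
  ring

/-- The total centred surprisal of a word, in units of `b`. -/
def scaledSurprisal {α : Type*} [Fintype α] (a : α → ℝ) (m : ℕ) (b : ℝ) (f : Fin m → α) : ℝ :=
  (∑ j, surprisal a (f j)) / b

theorem tpow_eq_exp {α : Type*} [Fintype α] {a : α → ℝ} {m : ℕ} {b : ℝ}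
    (hb : b ≠ 0) (f : Fin m → α) (hf : 0 < tpow a m f) :
    tpow a m f = Real.exp (-(m * shannonH a + b * scaledSurprisal a m b f)) := by
  have h0 : ∀ j ∈ univ, a (f j) ≠ 0 := prod_ne_zero_iff.1 hf.ne'
  rw [← Real.exp_log hf]
  congr 1
  rw [scaledSurprisal, mul_div_cancel₀ _ hb, tpow, Real.log_prod h0]
  simp only [surprisal, sum_sub_distrib, sum_neg_distrib, sum_const, card_univ, Fintype.card_fin,
    nsmul_eq_mul]
  ring

theorem sum_tpow_mul_exp {α : Type*} [Fintype α] (a X : α → ℝ) (m : ℕ) (θ : ℝ) :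
    ∑ f, tpow a m f * Real.exp (θ * ∑ j, X (f j)) = (∑ i, a i * Real.exp (θ * X i)) ^ m := by
  rw [← sum_tpow]
  refine sum_congr rfl fun f _ => ?_
  rw [tpow, tpow, prod_mul_distrib, ← Real.exp_sum, mul_sum]

theorem hasGaussianMgf_tpow {α : Type*} [Fintype α] {a : α → ℝ} (ha : IsProbDist a)
    {t : ℕ → ℝ} (ht : Tendsto t atTop (𝓝 0)) (htpos : ∀ᶠ n in atTop, 0 < t n) {N : ℕ → ℕ} {κ : ℝ}
    (hN : Tendsto (fun n => (N n : ℝ) / n) atTop (𝓝 κ)) {v : ℝ} (hv : v ^ 2 = 2 * κ * entV a) :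
    HasGaussianMgf (fun n => tpow a (N n)) (fun n => scaledSurprisal a (N n) (n * t n))
      (fun n => n * t n ^ 2) v := by
  intro l γ hγ
  obtain ⟨γ', hγ', hlt⟩ : ∃ γ' : ℝ, 0 < γ' ∧ κ * l ^ 2 * γ' < γ := by
    have hcont : Tendsto (fun x : ℝ => κ * l ^ 2 * x) (𝓝[>] 0) (𝓝 (κ * l ^ 2 * 0)) := by
      refine Tendsto.mono_left (Continuous.tendsto ?_ 0) nhdsWithin_le_nhds
      fun_prop
    obtain ⟨x, h1, h2⟩ := ((hcont.eventually (gt_mem_nhds (by simpa using hγ))).and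
      self_mem_nhdsWithin).exists
    exact ⟨x, h2, h1⟩
  have hlt0 : Tendsto (fun n => l * t n) atTop (𝓝 0) := by simpa using ht.const_mul l
  have hb := hlt0.eventually
    (eventually_mgf_bounds ha (sum_mul_surprisal ha) (sum_mul_surprisal_sq a) hγ')
  have hlow : ∀ᶠ n in atTop, l ^ 2 * v ^ 2 / 4 - γ <
      (N n : ℝ) / n * (l ^ 2 * (entV a / 2 - γ')) := by
    refine (hN.mul_const _).eventually (lt_mem_nhds ?_)
    rw [hv]
    nlinarith
  have hup : ∀ᶠ n in atTop, (N n : ℝ) / n * (l ^ 2 * (entV a / 2 + γ')) <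
      l ^ 2 * v ^ 2 / 4 + γ := by
    refine (hN.mul_const _).eventually (gt_mem_nhds ?_)
    rw [hv]
    nlinarith
  filter_upwards [hb, hlow, hup, htpos, eventually_gt_atTop 0] with n h1 h2 h3 h4 h5
  have hn : (0 : ℝ) < n := by exact_mod_cast h5
  have hE : (0 : ℝ) ≤ n * t n ^ 2 := by positivity
  have hsum : ∑ f, tpow a (N n) f *
      Real.exp (l * (n * t n ^ 2) * scaledSurprisal a (N n) (n * t n) f) =
      (∑ i, a i * Real.exp (l * t n * surprisal a i)) ^ N n := by
    rw [← sum_tpow_mul_exp]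
    refine sum_congr rfl fun f _ => ?_
    congr 2
    rw [scaledSurprisal]
    field_simp
  have hkey : ∀ x : ℝ, Real.exp ((l * t n) ^ 2 * x) ^ N n =
      Real.exp (n * t n ^ 2 * ((N n : ℝ) / n * (l ^ 2 * x))) := by
    intro x
    rw [← Real.exp_nat_mul]
    congr 1
    field_simp
  rw [hsum]
  constructor
  · refine le_trans ?_ (pow_le_pow_left₀ (Real.exp_pos _).le h1.1 _)
    rw [hkey, Real.exp_le_exp]
    exact mul_le_mul_of_nonneg_left h2.le hE
  · refine (pow_le_pow_left₀ (sum_nonneg fun i _ => mul_nonneg (ha.1 i) (Real.exp_pos _).le)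
      h1.2 _).trans ?_
    rw [hkey, Real.exp_le_exp]
    exact mul_le_mul_of_nonneg_left h3.le hE

theorem sum_le_headSum_exp {Ω : Type*} [Fintype Ω] {w Y : Ω → ℝ} (hw : IsProbDist w) {A b : ℝ}
    (hb : 0 < b) (hwY : ∀ ω, 0 < w ω → w ω = Real.exp (-(A + b * Y ω))) (z : ℝ) :
    ∑ ω with Y ω ≤ z, w ω ≤ headSum w (Real.exp (A + b * z)) := by
  have h1 : ∑ ω with Y ω ≤ z, w ω = ∑ ω with Y ω ≤ z ∧ 0 < w ω, w ω := by
    rw [← filter_filter]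
    refine (sum_filter_of_ne fun ω _ hne => (hw.1 ω).lt_of_ne hne.symm).symm
  rw [h1]
  refine sum_le_headSum hw.1 _ ?_
  have h2 : ((univ.filter fun ω => Y ω ≤ z ∧ 0 < w ω).card : ℝ) * Real.exp (-(A + b * z)) ≤ 1 := by
    rw [← hw.2, ← nsmul_eq_mul]
    refine le_trans (card_nsmul_le_sum _ w _ fun ω hω => ?_)
      (sum_le_sum_of_subset_of_nonneg (subset_univ _) fun ω _ _ => hw.1 ω)
    simp only [mem_filter, mem_univ, true_and] at hω
    rw [hwY ω hω.2, Real.exp_le_exp]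
    have := mul_le_mul_of_nonneg_left hω.1 hb.le
    linarith
  rwa [Real.exp_neg, ← div_eq_mul_inv, div_le_one (Real.exp_pos _)] at h2

theorem headSum_exp_le {Ω : Type*} [Fintype Ω] {w Y : Ω → ℝ} (hw : IsProbDist w) {A b : ℝ}
    (hb : 0 < b) (hwY : ∀ ω, 0 < w ω → w ω = Real.exp (-(A + b * Y ω))) (z δ : ℝ) :
    headSum w (Real.exp (A + b * z)) ≤ ∑ ω with Y ω < z + δ, w ω + Real.exp (-(b * δ)) := by
  obtain ⟨T, hT, hsum⟩ := exists_finset_headSum w (Real.exp_pos (A + b * z)).le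
  rw [hsum, ← sum_filter_add_sum_filter_not T fun ω => Y ω < z + δ]
  refine add_le_add (sum_le_sum_of_subset_of_nonneg (filter_subset_filter _ (subset_univ _))
    fun ω _ _ => hw.1 ω) ?_
  have h1 : ∀ ω ∈ T.filter (fun ω => ¬ Y ω < z + δ), w ω ≤ Real.exp (-(A + b * (z + δ))) := by
    intro ω hω
    have hY := not_lt.1 (mem_filter.1 hω).2
    rcases (hw.1 ω).eq_or_lt with h0 | h0
    · rw [← h0]; exact (Real.exp_pos _).le
    · rw [hwY ω h0, Real.exp_le_exp]
      have := mul_le_mul_of_nonneg_left hY hb.le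
      linarith
  refine (sum_le_card_nsmul _ _ _ h1).trans ?_
  rw [nsmul_eq_mul]
  calc ((T.filter fun ω => ¬ Y ω < z + δ).card : ℝ) * Real.exp (-(A + b * (z + δ)))
      ≤ Real.exp (A + b * z) * Real.exp (-(A + b * (z + δ))) :=
        mul_le_mul_of_nonneg_right
          (le_trans (by exact_mod_cast card_filter_le _ _) hT) (Real.exp_pos _).le
    _ = Real.exp (-(b * δ)) := by rw [← Real.exp_add]; ring_nf

/-- The monotone curves `g n`, with values in `[0, 1]`, approach a step at the origin with
Gaussian-type rate `(u / v) ^ 2` on the exponential scale `E n`. -/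
structure HasLorenzRate (g : ℕ → ℝ → ℝ) (E : ℕ → ℝ) (v : ℝ) : Prop where
  mono : ∀ᶠ n in atTop, Monotone (g n)
  nonneg : ∀ n z, 0 ≤ g n z
  le_one : ∀ n z, g n z ≤ 1
  left_le : ∀ u c : ℝ, 0 < u → c < (u / v) ^ 2 → ∀ᶠ n in atTop, g n (-u) ≤ Real.exp (-(c * E n))
  le_left : ∀ u c : ℝ, 0 < u → (u / v) ^ 2 < c → ∀ᶠ n in atTop, Real.exp (-(c * E n)) ≤ g n (-u)
  right_le : ∀ u c : ℝ, 0 < u → c < (u / v) ^ 2 →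
    ∀ᶠ n in atTop, 1 - g n u ≤ Real.exp (-(c * E n))
  le_right : ∀ u c : ℝ, 0 < u → (u / v) ^ 2 < c →
    ∀ᶠ n in atTop, Real.exp (-(c * E n)) ≤ 1 - g n u

theorem eventually_add_exp_le {E : ℕ → ℝ} (hE : Tendsto E atTop atTop) {c c' : ℝ} (h : c < c') :
    ∀ᶠ n in atTop, Real.exp (-(c' * E n)) + Real.exp (-(c' * E n)) < Real.exp (-(c * E n)) := by
  filter_upwards [hE.eventually_gt_atTop (Real.log 2 / (c' - c))] with n hn
  rw [div_lt_iff₀ (by linarith)] at hn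
  rw [← two_mul]
  have : (2 : ℝ) = Real.exp (Real.log 2) := (Real.exp_log (by norm_num)).symm
  rw [this, ← Real.exp_add, Real.exp_lt_exp]
  linarith

theorem eventually_exp_linear_le {t : ℕ → ℝ} (ht : Tendsto t atTop (𝓝 0))
    (htpos : ∀ᶠ n in atTop, 0 < t n) (c : ℝ) {δ : ℝ} (hδ : 0 < δ) :
    ∀ᶠ n : ℕ in atTop, Real.exp (-(n * t n * δ)) ≤ Real.exp (-(c * (n * t n ^ 2))) := by
  have h1 : Tendsto (fun n => c * t n) atTop (𝓝 0) := by simpa using ht.const_mul c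
  filter_upwards [h1.eventually (gt_mem_nhds hδ), htpos] with n h2 h3
  rw [Real.exp_le_exp, neg_le_neg_iff]
  calc c * (n * t n ^ 2) = n * t n * (c * t n) := by ring
    _ ≤ n * t n * δ := mul_le_mul_of_nonneg_left h2.le (by positivity)

theorem exists_pos_lt_sub_div_sq {u v c : ℝ} (hu : 0 < u) (h : c < (u / v) ^ 2) :
    ∃ δ : ℝ, 0 < δ ∧ 0 < u - δ ∧ c < ((u - δ) / v) ^ 2 := by
  have hcont : Tendsto (fun δ : ℝ => ((u - δ) / v) ^ 2) (𝓝[>] 0) (𝓝 (((u - 0) / v) ^ 2)) := by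
    refine Tendsto.mono_left (Continuous.tendsto ?_ 0) nhdsWithin_le_nhds
    fun_prop
  obtain ⟨δ, ⟨h1, h2⟩, h3⟩ := ((hcont.eventually (lt_mem_nhds (by simpa using h))).and
    (nhdsWithin_le_nhds (gt_mem_nhds hu)) |>.and self_mem_nhdsWithin).exists
  exact ⟨δ, h3, sub_pos.2 h2, h1⟩

theorem exists_pos_add_div_sq_lt {u v c : ℝ} (h : (u / v) ^ 2 < c) :
    ∃ δ : ℝ, 0 < δ ∧ ((u + δ) / v) ^ 2 < c := by
  have hcont : Tendsto (fun δ : ℝ => ((u + δ) / v) ^ 2) (𝓝[>] 0) (𝓝 (((u + 0) / v) ^ 2)) := by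
    refine Tendsto.mono_left (Continuous.tendsto ?_ 0) nhdsWithin_le_nhds
    fun_prop
  obtain ⟨δ, h1, h3⟩ := ((hcont.eventually (gt_mem_nhds (by simpa using h))).and
    self_mem_nhdsWithin).exists
  exact ⟨δ, h3, h1⟩

/-- The partial sums of `a ^ ⊗ N`, parametrised by the logarithm of the number of entries. -/
def logHead {α : Type*} [Fintype α] (a : α → ℝ) (m : ℕ) (b z : ℝ) : ℝ :=
  headSum (tpow a m) (Real.exp (m * shannonH a + b * z))

theorem hasLorenzRate_logHead {α : Type*} [Fintype α] {a : α → ℝ} (ha : IsProbDist a)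
    {t : ℕ → ℝ} (ht : Tendsto t atTop (𝓝 0)) (htpos : ∀ᶠ n in atTop, 0 < t n)
    (hE : Tendsto (fun n : ℕ => n * t n ^ 2) atTop atTop) {N : ℕ → ℕ} {κ : ℝ}
    (hN : Tendsto (fun n => (N n : ℝ) / n) atTop (𝓝 κ)) {v : ℝ} (hv0 : 0 < v)
    (hv : v ^ 2 = 2 * κ * entV a) :
    HasLorenzRate (fun n => logHead a (N n) (n * t n)) (fun n => n * t n ^ 2) v := by
  have hG := hasGaussianMgf_tpow ha ht htpos hN hv
  have hw : ∀ n f, 0 ≤ tpow a (N n) f := fun n => (ha.tpow (N n)).1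
  have hb : ∀ᶠ n : ℕ in atTop, 0 < n * t n := by
    filter_upwards [htpos, eventually_gt_atTop 0] with n h1 h2
    have : (0 : ℝ) < n := by exact_mod_cast h2
    positivity
  have hcompl : ∀ n (z : ℝ), ∑ f, tpow a (N n) f =
      ∑ f with scaledSurprisal a (N n) (n * t n) f < z, tpow a (N n) f +
      ∑ f with z ≤ scaledSurprisal a (N n) (n * t n) f, tpow a (N n) f := by
    intro n z
    rw [← sum_filter_add_sum_filter_not univ fun f => scaledSurprisal a (N n) (n * t n) f < z]
    simp only [not_lt]
  have hlow : ∀ᶠ n : ℕ in atTop, ∀ z,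
      ∑ f with scaledSurprisal a (N n) (n * t n) f ≤ z, tpow a (N n) f ≤
        logHead a (N n) (n * t n) z := by
    filter_upwards [hb] with n hn z
    exact sum_le_headSum_exp (ha.tpow _) hn (tpow_eq_exp hn.ne') z
  have hup : ∀ᶠ n : ℕ in atTop, ∀ z δ, logHead a (N n) (n * t n) z ≤
      ∑ f with scaledSurprisal a (N n) (n * t n) f < z + δ, tpow a (N n) f +
        Real.exp (-(n * t n * δ)) := by
    filter_upwards [hb] with n hn z δ
    exact headSum_exp_le (ha.tpow _) hn (tpow_eq_exp hn.ne') z δ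
  have hsub : ∀ n (y z : ℝ), y ≤ z →
      ∑ f with scaledSurprisal a (N n) (n * t n) f < y, tpow a (N n) f ≤
      ∑ f with scaledSurprisal a (N n) (n * t n) f ≤ z, tpow a (N n) f := by
    intro n y z hyz
    refine sum_le_sum_of_subset_of_nonneg (fun f hf => ?_) fun f _ _ => hw n f
    simp only [mem_filter, mem_univ, true_and] at hf ⊢
    exact hf.le.trans hyz
  refine ⟨?_, fun n z => headSum_nonneg (ha.tpow _).1 _,
    fun n z => headSum_le_one (ha.tpow _) (Real.exp_pos _).le, ?_, ?_, ?_, ?_⟩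
  · filter_upwards [hb] with n hn y z hyz
    refine headSum_mono (ha.tpow _).1 ?_
    gcongr
  · intro u c hu hc
    obtain ⟨δ, hδ, huδ, hcδ⟩ := exists_pos_lt_sub_div_sq hu hc
    obtain ⟨c', hcc', hc'⟩ := exists_between hcδ
    filter_upwards [hup, hG.neg.sum_tail_le hw hE hv0 huδ hc', eventually_add_exp_le hE hcc',
      eventually_exp_linear_le ht htpos c' hδ] with n h1 h2 h3 h4
    have h5 := h1 (-u) δ
    have h6 := hsub n (-u + δ) (-(u - δ)) (by linarith)
    simp only [le_neg] at h2
    linarith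
  · intro u c hu hc
    filter_upwards [hlow, hG.neg.le_sum_tail hw hE hv0 hu hc] with n h1 h2
    simp only [le_neg] at h2
    exact h2.trans (h1 _)
  · intro u c hu hc
    filter_upwards [hlow, hG.sum_tail_le hw hE hv0 hu hc] with n h1 h2
    have h3 := hcompl n u
    rw [(ha.tpow _).2] at h3
    linarith [h1 u, hsub n u u le_rfl]
  · intro u c hu hc
    obtain ⟨δ, hδ, hcδ⟩ := exists_pos_add_div_sq_lt hc
    obtain ⟨c', hc', hcc'⟩ := exists_between hcδ
    filter_upwards [hup, hG.le_sum_tail hw hE hv0 (by linarith : 0 < u + δ) hc',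
      eventually_add_exp_le hE hcc',
      eventually_exp_linear_le ht htpos c hδ] with n h1 h2 h3 h4
    have h5 := h1 u δ
    have h6 := hcompl n (u + δ)
    rw [(ha.tpow _).2] at h6
    linarith

theorem one_lt_div_sq_of_lt {u v : ℝ} (hv : 0 < v) (h : v < u) : 1 < (u / v) ^ 2 :=
  one_lt_pow₀ ((one_lt_div hv).2 h) two_ne_zero

theorem div_sq_lt_one_of_lt {u v : ℝ} (hu : 0 < u) (hv : 0 < v) (h : u < v) : (u / v) ^ 2 < 1 :=
  pow_lt_one₀ (div_nonneg hu.le hv.le) ((div_lt_one hv).2 h) two_ne_zero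

section Comparison

variable {gP gQ : ℕ → ℝ → ℝ} {E : ℕ → ℝ} {v w : ℝ}

theorem HasLorenzRate.eventually_le_add_exp_at (hP : HasLorenzRate gP E v)
    (hQ : HasLorenzRate gQ E w) (hv : 0 < v) (hw : 0 < w) {x y : ℝ} (hxy : |v - w| < y - x) :
    ∀ᶠ n in atTop, gP n x ≤ gQ n y + Real.exp (-E n) := by
  have habs := abs_nonneg (v - w)
  have hle := le_abs_self (v - w)
  have hle' := neg_abs_le (v - w)
  rcases lt_or_ge x 0 with hx | hx
  · have hu : 0 < -x := neg_pos.2 hx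
    rcases lt_or_ge v (-x) with hvx | hvx
    · filter_upwards [hP.left_le (-x) 1 hu (one_lt_div_sq_of_lt hv hvx)] with n hn
      rw [neg_neg, one_mul] at hn
      linarith [hQ.nonneg n y]
    · have h1 : -y < w * -x / v := by
        rw [lt_div_iff₀ hv]
        have h2 : (v - w) * -x ≤ |v - w| * v := by
          calc (v - w) * -x ≤ |v - w| * -x := mul_le_mul_of_nonneg_right hle hu.le
            _ ≤ |v - w| * v := mul_le_mul_of_nonneg_left hvx habs
        have h3 : |v - w| * v < (y - x) * v := mul_lt_mul_of_pos_right hxy hv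
        linarith
      have h2 : 0 < w * -x / v := by positivity
      obtain ⟨y₁, hy₁, hy₁'⟩ := exists_between (max_lt h1 h2)
      have hy₁0 : 0 < y₁ := (le_max_right _ _).trans_lt hy₁
      have hyy : -y₁ ≤ y := by linarith [(le_max_left (-y) 0).trans_lt hy₁]
      have hr : (y₁ / w) ^ 2 < (-x / v) ^ 2 := by
        refine pow_lt_pow_left₀ ?_ (by positivity) two_ne_zero
        rw [div_lt_iff₀ hw]
        calc y₁ < w * -x / v := hy₁'
          _ = -x / v * w := by ring
      obtain ⟨c, hc, hc'⟩ := exists_between hr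
      filter_upwards [hP.left_le (-x) c hu hc', hQ.le_left y₁ c hy₁0 hc, hQ.mono] with n h3 h4 h5
      rw [neg_neg] at h3
      linarith [h5 hyy, Real.exp_pos (-E n)]
  · have hy : 0 < y := by linarith
    rcases lt_or_ge w y with hwy | hwy
    · filter_upwards [hQ.right_le y 1 hy (one_lt_div_sq_of_lt hw hwy)] with n hn
      rw [one_mul] at hn
      linarith [hP.le_one n x]
    · have h1 : x < v * y / w := by
        rw [lt_div_iff₀ hw]
        have h2 : (w - v) * y ≤ |v - w| * w := by
          calc (w - v) * y ≤ |v - w| * y := mul_le_mul_of_nonneg_right (by linarith) hy.le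
            _ ≤ |v - w| * w := mul_le_mul_of_nonneg_left hwy habs
        have h3 : |v - w| * w < (y - x) * w := mul_lt_mul_of_pos_right hxy hw
        linarith
      obtain ⟨x₁, hx₁, hx₁'⟩ := exists_between h1
      have hx₁0 : 0 < x₁ := hx.trans_lt hx₁
      have hr : (x₁ / v) ^ 2 < (y / w) ^ 2 := by
        refine pow_lt_pow_left₀ ?_ (by positivity) two_ne_zero
        rw [div_lt_iff₀ hv]
        calc x₁ < v * y / w := hx₁'
          _ = y / w * v := by ring
      obtain ⟨c, hc, hc'⟩ := exists_between hr
      filter_upwards [hP.le_right x₁ c hx₁0 hc, hQ.right_le y c hy hc', hP.mono] with n h3 h4 h5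
      linarith [h5 hx₁.le, Real.exp_pos (-E n)]

theorem HasLorenzRate.eventually_forall_le_add_exp (hP : HasLorenzRate gP E v)
    (hQ : HasLorenzRate gQ E w) (hv : 0 < v) (hw : 0 < w) {c : ℝ} (hc : |v - w| < c) :
    ∀ᶠ n in atTop, ∀ z, gP n z ≤ gQ n (z + c) + Real.exp (-E n) := by
  obtain ⟨h, hh, hhc⟩ : ∃ h : ℝ, 0 < h ∧ |v - w| < c - 2 * h :=
    ⟨(c - |v - w|) / 4, by linarith, by linarith⟩
  have hcomp : ∀ᶠ n in atTop, ∀ z ∈ Set.Icc (-(v + 1)) (w + 1 - c),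
      gP n z ≤ gQ n (z + c) + Real.exp (-E n) := by
    refine isCompact_Icc.induction_on
      (p := fun s => ∀ᶠ n in atTop, ∀ z ∈ s, gP n z ≤ gQ n (z + c) + Real.exp (-E n))
      (by simp) (fun s₁ s₂ hs h => h.mono fun n hn z hz => hn z (hs hz)) ?_ fun x _ => ?_
    · intro s₁ s₂ h₁ h₂
      filter_upwards [h₁, h₂] with n hn₁ hn₂ z hz
      exact hz.elim (hn₁ z) (hn₂ z)
    · refine ⟨Set.Ioo (x - h) (x + h),
        mem_nhdsWithin_of_mem_nhds (Ioo_mem_nhds (by linarith) (by linarith)), ?_⟩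
      filter_upwards [hP.eventually_le_add_exp_at hQ hv hw (x := x + h) (y := x - h + c)
        (by linarith), hP.mono, hQ.mono] with n hn hmP hmQ z hz
      linarith [hmP hz.2.le, hmQ (show x - h + c ≤ z + c by linarith [hz.1])]
  filter_upwards [hcomp, hP.mono, hQ.mono,
    hP.left_le (v + 1) 1 (by linarith) (one_lt_div_sq_of_lt hv (by linarith)),
    hQ.right_le (w + 1) 1 (by linarith) (one_lt_div_sq_of_lt hw (by linarith))]
    with n h1 h2 h3 h4 h5 z
  rw [one_mul] at h4 h5
  rcases lt_or_ge z (-(v + 1)) with hz | hz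
  · linarith [h2 hz.le, hQ.nonneg n (z + c)]
  · rcases lt_or_ge (w + 1 - c) z with hz' | hz'
    · linarith [h3 (show w + 1 ≤ z + c by linarith), hP.le_one n z]
    · exact h1 z ⟨hz, hz'⟩

theorem HasLorenzRate.exists_eventually_add_exp_lt (hP : HasLorenzRate gP E v)
    (hQ : HasLorenzRate gQ E w) (hE : Tendsto E atTop atTop) (hv : 0 < v) (hw : 0 < w) {c : ℝ}
    (hc : c < |v - w|) :
    ∃ z, ∀ᶠ n in atTop, gQ n (z + c) + Real.exp (-E n) < gP n z := by
  rcases lt_abs.1 hc with hc | hc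
  · obtain ⟨u, hu, huv⟩ := exists_between (max_lt (show w + c < v by linarith) hv)
    have hu0 : 0 < u := (le_max_right _ _).trans_lt hu
    have huw : w < u - c := by linarith [(le_max_left (w + c) 0).trans_lt hu]
    obtain ⟨r, hr, hr'⟩ := exists_between (div_sq_lt_one_of_lt hu0 hv huv)
    refine ⟨-u, ?_⟩
    filter_upwards [hP.le_left u r hu0 hr,
      hQ.left_le (u - c) 1 (by linarith) (one_lt_div_sq_of_lt hw huw),
      eventually_add_exp_le hE hr'] with n h1 h2 h3
    rw [one_mul] at h2 h3
    rw [show -u + c = -(u - c) by ring]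
    linarith
  · obtain ⟨z, hz, hz'⟩ := exists_between
      (max_lt (show v < w - c by linarith) (show -c < w - c by linarith))
    have hvz : v < z := (le_max_left _ _).trans_lt hz
    have hzc : 0 < z + c := by linarith [(le_max_right v (-c)).trans_lt hz]
    obtain ⟨r, hr, hr'⟩ := exists_between
      (div_sq_lt_one_of_lt hzc hw (show z + c < w by linarith))
    refine ⟨z, ?_⟩
    filter_upwards [hQ.le_right (z + c) r hzc hr,
      hP.right_le z 1 (by linarith) (one_lt_div_sq_of_lt hv hvz),
      eventually_add_exp_le hE hr'] with n h1 h2 h3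
    rw [one_mul] at h2 h3
    linarith

theorem HasLorenzRate.eventually_forall_le_add_one_sub_exp (hP : HasLorenzRate gP E v)
    (hQ : HasLorenzRate gQ E w) (hv : 0 < v) (hw : 0 < w) {c : ℝ} (hc : -(v + w) < c) :
    ∀ᶠ n in atTop, ∀ z, gP n z ≤ gQ n (z + c) + (1 - Real.exp (-E n)) := by
  obtain ⟨x, hx, hxv⟩ := exists_between (max_lt (show -c - w < v by linarith) hv)
  have hx0 : 0 < x := (le_max_right _ _).trans_lt hx
  have hxw : -(x + c) < w := by linarith [(le_max_left (-c - w) 0).trans_lt hx]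
  obtain ⟨y, hy, hyw⟩ := exists_between (max_lt hxw hw)
  have hy0 : 0 < y := (le_max_right _ _).trans_lt hy
  have hyx : -y < x + c := by linarith [(le_max_left (-(x + c)) 0).trans_lt hy]
  filter_upwards [hP.mono, hQ.mono, hP.le_right x 1 hx0 (div_sq_lt_one_of_lt hx0 hv hxv),
    hQ.le_left y 1 hy0 (div_sq_lt_one_of_lt hy0 hw hyw)] with n h1 h2 h3 h4 z
  rw [one_mul] at h3 h4
  rcases le_total z x with hz | hz
  · linarith [h1 hz, hQ.nonneg n (z + c)]
  · linarith [h2 (show -y ≤ z + c by linarith), hP.le_one n z]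

theorem HasLorenzRate.exists_eventually_add_one_sub_exp_lt (hP : HasLorenzRate gP E v)
    (hQ : HasLorenzRate gQ E w) (hE : Tendsto E atTop atTop) (hv : 0 < v) (hw : 0 < w) {c : ℝ}
    (hc : c < -(v + w)) :
    ∃ z, ∀ᶠ n in atTop, gQ n (z + c) + (1 - Real.exp (-E n)) < gP n z := by
  obtain ⟨z, hz, hz'⟩ := exists_between (show v < -c - w by linarith)
  have hzc : w < -(z + c) := by linarith
  obtain ⟨r, hr, hr'⟩ := exists_between
    (lt_min (one_lt_div_sq_of_lt hv hz) (one_lt_div_sq_of_lt hw hzc))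
  refine ⟨z, ?_⟩
  filter_upwards [hP.right_le z r (by linarith) (hr'.trans_le (min_le_left _ _)),
    hQ.left_le (-(z + c)) r (by linarith) (hr'.trans_le (min_le_right _ _)),
    eventually_add_exp_le hE hr] with n h1 h2 h3
  rw [neg_neg] at h2
  rw [one_mul] at h3
  linarith

end Comparison

theorem logHead_eq_headSum {α : Type*} [Fintype α] (a : α → ℝ) (m : ℕ) {b : ℝ} (hb : b ≠ 0)
    {K : ℝ} (hK : 0 < K) :
    logHead a m b ((Real.log K - m * shannonH a) / b) = headSum (tpow a m) K := by
  rw [logHead, mul_div_cancel₀ _ hb, add_sub_cancel, Real.exp_log hK]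

/-- The conversion rate is determined to second order by the shift `c₀` at which the Lorenz curve
of `q ^ ⊗ m` starts to dominate that of `p ^ ⊗ n` up to the allowed error. -/
theorem tendsto_rate_of_threshold {α β : Type*} [Fintype α] [Fintype β] {p : α → ℝ} {q : β → ℝ}
    (hq : IsProbDist q) (hHp : 0 < shannonH p) (hHq : 0 < shannonH q)
    {t : ℕ → ℝ} (ht : Tendsto t atTop (𝓝 0)) (htpos : ∀ᶠ n in atTop, 0 < t n)
    (hE : Tendsto (fun n : ℕ => n * t n ^ 2) atTop atTop) {ε : ℕ → ℝ} (hε : ∀ n, 0 ≤ ε n) {c₀ : ℝ}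
    (hach : ∀ N : ℕ → ℕ, Tendsto (fun n => (N n : ℝ) / n) atTop (𝓝 (shannonH p / shannonH q)) →
      ∀ c, c₀ < c → ∀ᶠ n in atTop, ∀ z,
        logHead p n (n * t n) z ≤ logHead q (N n) (n * t n) (z + c) + ε n)
    (hconv : ∀ N : ℕ → ℕ, Tendsto (fun n => (N n : ℝ) / n) atTop (𝓝 (shannonH p / shannonH q)) →
      ∀ c, c < c₀ → ∃ z, ∀ᶠ n in atTop,
        logHead q (N n) (n * t n) (z + c) + ε n < logHead p n (n * t n) z) :
    Tendsto (fun n : ℕ => (((sSup {m : ℕ | ∀ j : ℕ, headSum (tpow p n) (j : ℝ) ≤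
      headSum (tpow q m) (j : ℝ) + ε n} : ℕ) : ℝ) / n - shannonH p / shannonH q) / t n)
      atTop (𝓝 (-c₀ / shannonH q)) := by
  set S : ℕ → Set ℕ := fun n => {m : ℕ | ∀ j : ℕ, headSum (tpow p n) (j : ℝ) ≤
      headSum (tpow q m) (j : ℝ) + ε n} with hS
  set x : ℝ → ℕ → ℝ := fun c n => (n * shannonH p - c * (n * t n)) / shannonH q with hx
  have hb : ∀ᶠ n : ℕ in atTop, 0 < n * t n := by
    filter_upwards [htpos, eventually_gt_atTop 0] with n h1 h2
    have : (0 : ℝ) < n := by exact_mod_cast h2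
    positivity
  have hnt : Tendsto (fun n : ℕ => n * t n) atTop atTop := by
    refine tendsto_atTop_mono' _ ?_ hE
    filter_upwards [htpos, ht.eventually (gt_mem_nhds one_pos)] with n h1 h2
    have h3 : (0 : ℝ) ≤ n * t n := by positivity
    calc (n : ℝ) * t n ^ 2 = n * t n * t n := by ring
      _ ≤ n * t n * 1 := mul_le_mul_of_nonneg_left h2.le h3
      _ = n * t n := mul_one _
  have hx0 : ∀ c, ∀ᶠ n : ℕ in atTop, 0 ≤ x c n := by
    intro c
    have h1 : Tendsto (fun n => c * t n) atTop (𝓝 0) := by simpa using ht.const_mul c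
    filter_upwards [h1.eventually (gt_mem_nhds hHp)] with n h2
    refine div_nonneg ?_ hHq.le
    have : (n : ℝ) * shannonH p - c * (n * t n) = n * (shannonH p - c * t n) := by ring
    rw [this]
    exact mul_nonneg (Nat.cast_nonneg _) (by linarith)
  have hxlim : ∀ c, Tendsto (fun n : ℕ => x c n / n) atTop (𝓝 (shannonH p / shannonH q)) := by
    intro c
    have h1 : Tendsto (fun n => (shannonH p - c * t n) / shannonH q) atTop
        (𝓝 ((shannonH p - c * 0) / shannonH q)) :=
      ((ht.const_mul c).const_sub _).div_const _
    rw [mul_zero, sub_zero] at h1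
    refine h1.congr' ?_
    filter_upwards [eventually_gt_atTop 0] with n hn
    have : (0 : ℝ) < n := by exact_mod_cast hn
    simp only [hx]
    field_simp
  have hN : ∀ c, Tendsto (fun n : ℕ => ((⌊x c n⌋₊ : ℕ) : ℝ) / n) atTop
      (𝓝 (shannonH p / shannonH q)) := by
    intro c
    have h1 : Tendsto (fun n : ℕ => x c n / n - 1 / (n : ℝ)) atTop
        (𝓝 (shannonH p / shannonH q - 0)) :=
      (hxlim c).sub tendsto_one_div_atTop_nhds_zero_nat
    rw [sub_zero] at h1
    refine tendsto_of_tendsto_of_tendsto_of_le_of_le' h1 (hxlim c) ?_ ?_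
    · filter_upwards with n
      rw [← sub_div]
      have := Nat.lt_floor_add_one (x c n)
      gcongr
      linarith
    · filter_upwards [hx0 c] with n hn
      have := Nat.floor_le hn
      gcongr
  have hmem : ∀ c, c₀ < c → ∀ᶠ n : ℕ in atTop, ⌊x c n⌋₊ ∈ S n := by
    intro c hc
    filter_upwards [hach _ (hN c) c hc, hb, hx0 c] with n h1 h2 h3 j
    rcases Nat.eq_zero_or_pos j with rfl | hj
    · simpa [headSum_zero] using hε n
    · have hj' : (0 : ℝ) < j := by exact_mod_cast hj
      have h4 := h1 ((Real.log j - n * shannonH p) / (n * t n))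
      rw [logHead_eq_headSum p n h2.ne' hj'] at h4
      refine h4.trans (add_le_add_left (headSum_mono (hq.tpow _).1 ?_) _)
      rw [mul_add, mul_div_cancel₀ _ h2.ne', ← Real.le_log_iff_exp_le hj']
      have h5 := Nat.floor_le h3
      rw [hx, le_div_iff₀ hHq] at h5
      linarith
  have hnot : ∀ c, c < c₀ → ∀ᶠ n : ℕ in atTop, ∀ m ∈ S n, m ≤ ⌊x c n⌋₊ := by
    intro c hc
    obtain ⟨c', hcc', hc'⟩ := exists_between hc
    obtain ⟨z, hz⟩ := hconv _ (hN c) c' hc'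
    filter_upwards [hz, hb, hnt.eventually_ge_atTop (shannonH q / (c' - c))]
      with n h1 h2 h3 m hm
    by_contra! hlt
    rw [div_le_iff₀ (by linarith)] at h3
    have h4 := Nat.lt_floor_add_one (x c n)
    rw [hx, div_lt_iff₀ hHq] at h4
    set K := Real.exp (n * shannonH p + n * t n * z) with hK
    have hK0 : 0 ≤ K := (Real.exp_pos _).le
    have h5 := hm ⌊K⌋₊
    rw [headSum_floor _ hK0, headSum_floor _ hK0] at h5
    have h6 := headSum_tpow_antitone hq hK0 hlt.le
    have h7 : headSum (tpow q ⌊x c n⌋₊) K ≤ logHead q ⌊x c n⌋₊ (n * t n) (z + c') := by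
      refine headSum_mono (hq.tpow _).1 ?_
      rw [hK, Real.exp_le_exp]
      linarith
    have h8 : logHead p n (n * t n) z = headSum (tpow p n) K := rfl
    dsimp only at h6
    linarith
  have hbdd : ∀ᶠ n : ℕ in atTop, BddAbove (S n) := by
    filter_upwards [hnot (c₀ - 1) (by linarith)] with n hn
    exact ⟨_, hn⟩
  have hscale : ∀ c, ∀ᶠ n : ℕ in atTop,
      (x c n / n - shannonH p / shannonH q) / t n = -c / shannonH q := by
    intro c
    filter_upwards [htpos, eventually_gt_atTop 0] with n h1 h2
    have : (0 : ℝ) < n := by exact_mod_cast h2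
    simp only [hx]
    field_simp
    ring
  rw [tendsto_order]
  constructor
  · intro a ha
    rw [lt_div_iff₀ hHq] at ha
    obtain ⟨b, hab, hb'⟩ := exists_between ha
    have hbc : c₀ < -b := by linarith
    have hsmall : Tendsto (fun n : ℕ => -(-b) / shannonH q - 1 / (n * t n)) atTop
        (𝓝 (-(-b) / shannonH q - 0)) := by
      refine tendsto_const_nhds.sub ?_
      simp only [one_div]
      exact tendsto_inv_atTop_zero.comp hnt
    have hlt : a < -(-b) / shannonH q - 0 := by
      rw [sub_zero, neg_neg, lt_div_iff₀ hHq]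
      exact hab
    filter_upwards [hmem _ hbc, hbdd, hscale (-b), htpos, eventually_gt_atTop 0,
      hsmall.eventually (lt_mem_nhds hlt)] with n h1 h2 h3 h4 h5 h6
    have hn : (0 : ℝ) < n := by exact_mod_cast h5
    have h7 : x (-b) n - 1 ≤ ((sSup (S n) : ℕ) : ℝ) := by
      have h8 : ((⌊x (-b) n⌋₊ : ℕ) : ℝ) ≤ ((sSup (S n) : ℕ) : ℝ) := by
        exact_mod_cast le_csSup h2 h1
      linarith [Nat.lt_floor_add_one (x (-b) n)]
    refine h6.trans_le ?_
    rw [← h3]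
    calc (x (-b) n / n - shannonH p / shannonH q) / t n - 1 / (n * t n)
        = ((x (-b) n - 1) / n - shannonH p / shannonH q) / t n := by field_simp; ring
      _ ≤ _ := by gcongr
  · intro a ha
    rw [gt_iff_lt, div_lt_iff₀ hHq] at ha
    obtain ⟨b, hb', hab⟩ := exists_between ha
    have hbc : -b < c₀ := by linarith
    filter_upwards [hnot _ hbc, hmem (c₀ + 1) (by linarith), hscale (-b), htpos, hx0 (-b)]
      with n h1 h2 h3 h4 h5
    have h7 : ((sSup (S n) : ℕ) : ℝ) ≤ x (-b) n := by
      refine le_trans ?_ (Nat.floor_le h5)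
      exact_mod_cast csSup_le ⟨_, h2⟩ h1
    calc (((sSup (S n) : ℕ) : ℝ) / n - shannonH p / shannonH q) / t n
        ≤ (x (-b) n / n - shannonH p / shannonH q) / t n := by gcongr
      _ = b / shannonH q := by rw [h3, neg_neg]
      _ < a := by rwa [div_lt_iff₀ hHq]

/-- Moderate deviation expansion of the optimal entanglement-direction conversion rate,
for both the direct and converse regimes. -/
theorem entanglement_direct_and_converse
    {dp dq ds : ℕ} (p : Fin dp → ℝ) (q : Fin dq → ℝ) (s : Fin ds → ℝ)
    (hp : IsProbDist p) (hq : IsProbDist q)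
    (hs : IsProbDist s) (hsharp : IsSharp s)
    (hHp : 0 < shannonH p) (hHq : 0 < shannonH q)
    (hVp : 0 < entV p) (hVq : 0 < entV q)
    (t : ℕ → ℝ) (ht : ModerateSeq t)
    (R : ℕ → ℝ → ℝ)
    (hR : ∀ n : ℕ, ∀ e : ℝ, 0 ≤ e → R n e =
      (↑(sSup {m : ℕ | ApproxSubMajTV (tensor (tpow p n) (tpow s m))
          (tensor (tpow q m) (tpow s n)) e}) : ℝ) / (n : ℝ))
    (ν : ℝ) (hν : ν = (entV p / shannonH p) / (entV q / shannonH q)) :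
    Tendsto (fun n : ℕ =>
        (R n (Real.exp (-((n : ℝ) * t n ^ 2))) - shannonH p / shannonH q) / t n)
      atTop (𝓝 (-(Real.sqrt (2 * entV p) / shannonH q) * |1 - 1 / Real.sqrt ν|)) ∧
    Tendsto (fun n : ℕ =>
        (R n (1 - Real.exp (-((n : ℝ) * t n ^ 2))) - shannonH p / shannonH q) / t n)
      atTop (𝓝 (Real.sqrt (2 * entV p) / shannonH q * |1 + 1 / Real.sqrt ν|)) := by
  have hn0 : ∀ n : ℕ, (0 : ℝ) ≤ n := fun n => Nat.cast_nonneg n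
  have htpos : ∀ᶠ n in atTop, 0 < t n := by
    filter_upwards [ht.2.eventually_gt_atTop 0] with n hn
    exact pos_of_mul_pos_right hn (Real.sqrt_nonneg _)
  have hE : Tendsto (fun n : ℕ => n * t n ^ 2) atTop atTop := by
    refine ((tendsto_pow_atTop two_ne_zero).comp ht.2).congr fun n => ?_
    simp only [Function.comp_apply, mul_pow, Real.sq_sqrt (hn0 n)]
  set v := Real.sqrt (2 * entV p) with hv
  set w := Real.sqrt (2 * (shannonH p / shannonH q) * entV q) with hw
  have hv0 : 0 < v := Real.sqrt_pos.2 (by positivity)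
  have hw0 : 0 < w := Real.sqrt_pos.2 (by positivity)
  have hv2 : v ^ 2 = 2 * 1 * entV p := by rw [hv, Real.sq_sqrt (by positivity), mul_one]
  have hw2 : w ^ 2 = 2 * (shannonH p / shannonH q) * entV q := Real.sq_sqrt (by positivity)
  have hwv : w = v * (1 / Real.sqrt ν) := by
    have hν0 : 0 ≤ ν := by rw [hν]; positivity
    rw [mul_one_div, hv, ← Real.sqrt_div' _ hν0, hw, hν]
    congr 1
    field_simp
  have hone : Tendsto (fun n : ℕ => (n : ℝ) / n) atTop (𝓝 1) := by
    refine tendsto_const_nhds.congr' ?_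
    filter_upwards [eventually_gt_atTop 0] with n hn
    rw [div_self (by positivity)]
  have hP := hasLorenzRate_logHead hp ht.1 htpos hE hone hv0 hv2
  have hQ := fun (N : ℕ → ℕ) hN =>
    hasLorenzRate_logHead hq ht.1 htpos hE (N := N) hN hw0 hw2
  have hε : ∀ n : ℕ, 0 ≤ 1 - Real.exp (-((n : ℝ) * t n ^ 2)) := fun n => by
    rw [sub_nonneg, Real.exp_le_one_iff, neg_nonpos]
    exact mul_nonneg (hn0 n) (sq_nonneg _)
  constructor
  · have key := tendsto_rate_of_threshold hq hHp hHq ht.1 htpos hE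
      (fun n => (Real.exp_pos (-((n : ℝ) * t n ^ 2))).le) (c₀ := |v - w|)
      (fun N hN c hc => hP.eventually_forall_le_add_exp (hQ N hN) hv0 hw0 hc)
      (fun N hN c hc => hP.exists_eventually_add_exp_lt (hQ N hN) hE hv0 hw0 hc)
    convert key using 2
    · rename_i n
      simp only [hR n _ (Real.exp_pos _).le,
        approxSubMajTV_tensor_iff hp hq hsharp _ _ (Real.exp_pos _).le]
    · rw [hwv, show v - v * (1 / Real.sqrt ν) = v * (1 - 1 / Real.sqrt ν) by ring, abs_mul,
        abs_of_pos hv0]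
      ring
  · have key := tendsto_rate_of_threshold hq hHp hHq ht.1 htpos hE hε (c₀ := -(v + w))
      (fun N hN c hc => hP.eventually_forall_le_add_one_sub_exp (hQ N hN) hv0 hw0 hc)
      (fun N hN c hc => hP.exists_eventually_add_one_sub_exp_lt (hQ N hN) hE hv0 hw0 hc)
    convert key using 2
    · rename_i n
      simp only [hR n _ (hε n), approxSubMajTV_tensor_iff hp hq hsharp _ _ (hε n)]
    · rw [hwv, abs_of_pos (by positivity)]
      ring
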